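/- arXiv:1206.1934 — 2 statements merged into one kernel-verified Lean document; each statement's English description precedes it below -/
import Mathlib

section
/- (Integral analogue of the Kupavskii lemma.) Let A : Fin 3 → ℤ be a point of ℤ³ such that A 0 + A 1 + A 2 is even and gcd(A 0, A 1, A 2) = 1. Let m be an even natural number with m = b₀² + b₁² + b₂² for some integers b₀, b₁, b₂ satisfying gcd(b₀, b₁, b₂) = 1. Let C be any type and c : (Fin 3 → ℤ) → C a colouring that is proper for forbidden distance √m (i.e., whenever ∑ i, (x i - y i)^2 = m one has c x ≠ c y) and that takes at least two distinct values. Then there exists a bijection f : (Fin 3 → ℤ) ≃ (Fin 3 → ℤ) preserving squared Euclidean distances (∀ x y, ∑ i, (f x i - f y i)^2 = ∑ i, (x i - y i)^2) such that c (f 0) ≠ c (f A), where 0 denotes the origin. -/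
/-- The group of periods of a colouring `c` of an additive commutative group. -/
def periodSubgroup {G C : Type*} [AddCommGroup G] (c : G → C) : AddSubgroup G where
  carrier := {v | ∀ x, c (x + v) = c x}
  zero_mem' := fun x => by rw [add_zero]
  add_mem' := fun {u v} hu hv x => by rw [← add_assoc, hv, hu]
  neg_mem' := fun {v} hv x => by
    have h := hv (x + -v)
    rw [neg_add_cancel_right] at h
    exact h.symm

/-- The isometry of `ℤⁿ` given by permuting the coordinates, changing their signs and
translating. -/
def signedPermIsometry {ι : Type*} (σ : Equiv.Perm ι) (s : ι → ℤˣ) (p : ι → ℤ) :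
    (ι → ℤ) ≃ (ι → ℤ) where
  toFun x i := p i + s i * x (σ i)
  invFun y i := s (σ.symm i) * (y (σ.symm i) - p (σ.symm i))
  left_inv x := by
    funext i
    simp [← mul_assoc, ← Units.val_mul]
  right_inv y := by
    funext i
    simp [← mul_assoc, ← Units.val_mul]

theorem sum_sq_sub_signedPermIsometry {ι : Type*} [Fintype ι] (σ : Equiv.Perm ι) (s : ι → ℤˣ)
    (p x y : ι → ℤ) :
    ∑ i, (signedPermIsometry σ s p x i - signedPermIsometry σ s p y i) ^ 2 =
      ∑ i, (x i - y i) ^ 2 := by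
  rw [← Equiv.sum_comp σ fun i => (x i - y i) ^ 2]
  refine Finset.sum_congr rfl fun i _ => ?_
  have hs : ((s i : ℤˣ) : ℤ) ^ 2 = 1 := by
    rw [← Units.val_pow_eq_pow_val, Int.units_sq, Units.val_one]
  change (p i + s i * x (σ i) - (p i + s i * y (σ i))) ^ 2 = _
  linear_combination (x (σ i) - y (σ i)) ^ 2 * hs

/-- An integer point of even coordinate sum has no odd coordinate, or exactly one even one. -/
theorem forall_even_or_exists_even_iff_eq {v : Fin 3 → ℤ} (hv : Even (v 0 + v 1 + v 2)) :
    (∀ i, Even (v i)) ∨ ∃ k, ∀ i, Even (v i) ↔ i = k := by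
  simp only [Fin.forall_fin_succ, Fin.exists_fin_succ, Int.even_add] at *
  simp [-Int.not_even_iff_odd] at *
  tauto

section SignedPermInvariant

variable {ι : Type*} [DecidableEq ι] {A : ι → ℤ} {H : AddSubgroup (ι → ℤ)}

theorem single_two_mul_mem (hH : ∀ (σ : Equiv.Perm ι) (s : ι → ℤˣ),
    (fun i => (s i : ℤ) * A (σ i)) ∈ H) (i k : ι) : Pi.single i (2 * A k) ∈ H := by
  convert H.sub_mem (hH (Equiv.swap i k) 1) (hH (Equiv.swap i k) (Function.update 1 i (-1))) using 1
  funext j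
  rcases eq_or_ne j i with rfl | hj
  · simp [two_mul]
  · simp [hj]

theorem mem_of_forall_even [Fintype ι] (hH : ∀ i, (Pi.single i 2 : ι → ℤ) ∈ H) {v : ι → ℤ}
    (hv : ∀ i, Even (v i)) : v ∈ H := by
  rw [← Finset.univ_sum_single v]
  refine H.sum_mem fun i _ => ?_
  obtain ⟨z, hz⟩ := hv i
  convert H.zsmul_mem (hH i) z using 1
  rw [← Pi.single_smul, hz, smul_eq_mul, mul_two]

end SignedPermInvariant

/-- A subgroup of `ℤ³` containing all signed permutations of a primitive point of even coordinate
sum contains every point of even coordinate sum. -/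
theorem mem_of_even_sum {A : Fin 3 → ℤ} (hEven : Even (A 0 + A 1 + A 2))
    (hgcd : Int.gcd (A 0) (Int.gcd (A 1) (A 2)) = 1) {H : AddSubgroup (Fin 3 → ℤ)}
    (hH : ∀ (σ : Equiv.Perm (Fin 3)) (s : Fin 3 → ℤˣ), (fun i => (s i : ℤ) * A (σ i)) ∈ H)
    {v : Fin 3 → ℤ} (hv : Even (v 0 + v 1 + v 2)) : v ∈ H := by
  have htwo : ∀ i, (Pi.single i 2 : Fin 3 → ℤ) ∈ H := by
    intro i
    have h₁ := Int.gcd_eq_gcd_ab (A 0) (Int.gcd (A 1) (A 2))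
    have h₂ := Int.gcd_eq_gcd_ab (A 1) (A 2)
    rw [hgcd, Nat.cast_one] at h₁
    generalize Int.gcdA (A 0) _ = p, Int.gcdB (A 0) _ = q at h₁
    generalize Int.gcdA (A 1) (A 2) = r, Int.gcdB (A 1) (A 2) = t at h₂
    have hmem := H.add_mem (H.zsmul_mem (single_two_mul_mem hH i 0) p)
      (H.add_mem (H.zsmul_mem (single_two_mul_mem hH i 1) (q * r))
        (H.zsmul_mem (single_two_mul_mem hH i 2) (q * t)))
    simp only [← Pi.single_smul, ← Pi.single_add, smul_eq_mul] at hmem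
    convert hmem using 1
    refine congrArg (Pi.single i) ?_
    linear_combination 2 * h₁ + 2 * q * h₂
  rcases forall_even_or_exists_even_iff_eq hv with hv | ⟨k, hk⟩
  · exact mem_of_forall_even htwo hv
  obtain ⟨a, ha⟩ : ∃ a, ∀ i, Even (A i) ↔ i = a := by
    refine (forall_even_or_exists_even_iff_eq hEven).resolve_left fun h => ?_
    have hdvd := Int.dvd_coe_gcd (h 0).two_dvd (Int.dvd_coe_gcd (h 1).two_dvd (h 2).two_dvd)
    rw [hgcd] at hdvd
    norm_num at hdvd
  have hdiff : v - (fun i => A (Equiv.swap a k i)) ∈ H := by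
    refine mem_of_forall_even htwo fun i => ?_
    rw [Pi.sub_apply, Int.even_sub, hk, ha, Equiv.swap_apply_eq_iff, Equiv.swap_apply_left]
  have hA := hH (Equiv.swap a k) 1
  simp only [Pi.one_apply, Units.val_one, one_mul] at hA
  simpa using H.add_mem hdiff hA

/-- Integral analogue of the Kupavskii lemma: given a point `A ∈ ℤ³` with even
coordinate sum and coprime coordinates, and an even `m` which is a sum of three
coprime integer squares, every proper colouring of `ℤ³` with forbidden distance
`√m` taking at least two values admits an isometry of `ℤ³` moving the pair
`(0, A)` to a pair of points with different colours. -/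
theorem kupavskii_lemma_integral (A : Fin 3 → ℤ)
    (hEven : Even (A 0 + A 1 + A 2))
    (hgcdA : Int.gcd (A 0) (Int.gcd (A 1) (A 2)) = 1)
    (m : ℕ) (hm : Even m) (b₀ b₁ b₂ : ℤ)
    (hb : (m : ℤ) = b₀ ^ 2 + b₁ ^ 2 + b₂ ^ 2)
    (hgcdb : Int.gcd b₀ (Int.gcd b₁ b₂) = 1)
    (C : Type*) (c : (Fin 3 → ℤ) → C)
    (hproper : ∀ x y : Fin 3 → ℤ, ∑ i, (x i - y i) ^ 2 = (m : ℤ) → c x ≠ c y)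
    (hnontriv : ∃ x y : Fin 3 → ℤ, c x ≠ c y) :
    ∃ f : (Fin 3 → ℤ) ≃ (Fin 3 → ℤ),
      (∀ x y : Fin 3 → ℤ, ∑ i, (f x i - f y i) ^ 2 = ∑ i, (x i - y i) ^ 2) ∧
      c (f 0) ≠ c (f A) := by
  by_contra! hcon
  have hperiod : ∀ (σ : Equiv.Perm (Fin 3)) (s : Fin 3 → ℤˣ),
      (fun i => (s i : ℤ) * A (σ i)) ∈ periodSubgroup c := by
    intro σ s x
    have h := hcon (signedPermIsometry σ s x) (sum_sq_sub_signedPermIsometry σ s x)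
    have h₀ : signedPermIsometry σ s x 0 = x := by
      funext i
      simp [signedPermIsometry]
    rw [h₀] at h
    exact h.symm
  have hbEven : Even (b₀ + b₁ + b₂) := by
    have h : Even (m : ℤ) := by exact_mod_cast hm
    rw [hb] at h
    simpa [Int.even_add, Int.even_pow] using h
  have hmem : ![b₀, b₁, b₂] ∈ periodSubgroup c :=
    mem_of_even_sum hEven hgcdA hperiod (by simpa using hbEven)
  refine hproper (0 + ![b₀, b₁, b₂]) 0 ?_ (hmem 0)
  simp [Fin.sum_univ_three, hb]
end

section
/- Let p be a prime and let g be a primitive root modulo p, i.e., g : (ZMod p)ˣ is an element of order p - 1. Then the set {(k, g^k)} is a Sidon-type set: for all natural numbers k₁, k₂, k₃, k₄, if k₁ + k₄ ≡ k₂ + k₃ (mod p - 1) and g^{k₁} + g^{k₄} = g^{k₂} + g^{k₃} (in ZMod p, after coercion of units), then k₁ ≡ k₂ (mod p - 1) or k₁ ≡ k₃ (mod p - 1). Equivalently, no four pairwise distinct elements a, b, c, d of the set {(k mod (p-1), g^k mod p)} satisfy a - b = c - d. -/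
/-- For a prime `p` and a primitive root `g` mod `p`, the set `{(k, gᵏ)}` is a
Sidon-type set: if `k₁ + k₄ ≡ k₂ + k₃ (mod p - 1)` and
`g^k₁ + g^k₄ = g^k₂ + g^k₃` in `ZMod p`, then `k₁ ≡ k₂` or `k₁ ≡ k₃ (mod p-1)`. -/
theorem primitive_root_sidon (p : ℕ) (hp : p.Prime) (g : (ZMod p)ˣ)
    (hg : orderOf g = p - 1) (k₁ k₂ k₃ k₄ : ℕ)
    (hmod : k₁ + k₄ ≡ k₂ + k₃ [MOD p - 1])
    (hsum : (g : ZMod p) ^ k₁ + (g : ZMod p) ^ k₄ =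
      (g : ZMod p) ^ k₂ + (g : ZMod p) ^ k₃) :
    k₁ ≡ k₂ [MOD p - 1] ∨ k₁ ≡ k₃ [MOD p - 1] := by
  have := Fact.mk hp
  rw [← hg] at hmod ⊢
  simp only [← pow_eq_pow_iff_modEq, Units.ext_iff, Units.val_pow_eq_pow_val, pow_add,
    Units.val_mul] at hmod ⊢
  have hprod : ((g : ZMod p) ^ k₁ - (g : ZMod p) ^ k₂) *
      ((g : ZMod p) ^ k₁ - (g : ZMod p) ^ k₃) = 0 := by
    linear_combination (g : ZMod p) ^ k₁ * hsum - hmod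
  exact (mul_eq_zero.mp hprod).imp sub_eq_zero.mp sub_eq_zero.mp
end
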